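/- arXiv:0803.2483 — 4 statements merged into one kernel-verified Lean document; each statement's English description precedes it below -/
import Mathlib

section
/- There is an absolute constant C > 0 such that for every integer r ≥ 1 and every real x ≥ 1, |Σ_{m ≤ x, gcd(m,r)=1} μ(m)² − 6x/(π² ∏_{p|r}(1 + 1/p))| ≤ C √x φ(r), where the product is over the primes p dividing r. -/
open Finset

lemma card_coprime_Icc_mul (r q : ℕ) :
    #{n ∈ Icc 1 (q * r) | Nat.Coprime n r} = q * r.totient := by
  induction q with
  | zero => simp
  | succ q ih =>
    have hIcc : Icc 1 ((q + 1) * r) = Icc 1 (q * r) ∪ Ico (q * r + 1) (q * r + 1 + r) := by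
      ext n
      simp only [mem_Icc, mem_union, mem_Ico, add_mul, one_mul]
      omega
    have hdisj : Disjoint (Icc 1 (q * r)) (Ico (q * r + 1) (q * r + 1 + r)) := by
      rw [disjoint_left]
      intro n
      simp only [mem_Icc, mem_Ico]
      omega
    have hperiod := Nat.filter_coprime_Ico_eq_totient r (q * r + 1)
    simp only [Nat.coprime_comm (n := r)] at hperiod
    rw [hIcc, filter_union, card_union_of_disjoint (disjoint_filter_filter hdisj), ih, hperiod,
      add_mul, one_mul]

lemma abs_card_coprime_sub_le {r : ℕ} (hr : 1 ≤ r) {y : ℝ} (hy : 0 ≤ y) :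
    |(#{n ∈ Icc 1 ⌊y⌋₊ | Nat.Coprime n r} : ℝ) - y * (r.totient / r)| ≤ r.totient := by
  have hr0 : (0 : ℝ) < r := by exact_mod_cast hr
  have hφ : (0 : ℝ) ≤ r.totient := by positivity
  set q := ⌊y / r⌋₊ with hq
  have hq1 : (q : ℝ) * r ≤ y := by
    rw [← le_div_iff₀ hr0]; exact Nat.floor_le (by positivity)
  have hq2 : y < ((q : ℝ) + 1) * r := by
    rw [← div_lt_iff₀ hr0]; exact Nat.lt_floor_add_one _
  have hn1 : q * r ≤ ⌊y⌋₊ := Nat.le_floor (by exact_mod_cast hq1)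
  have hn2 : ⌊y⌋₊ ≤ (q + 1) * r := by
    have : ⌊y⌋₊ < (q + 1) * r := (Nat.floor_lt hy).2 (by exact_mod_cast hq2)
    exact this.le
  have hc1 : (q * r.totient : ℝ) ≤ #{n ∈ Icc 1 ⌊y⌋₊ | Nat.Coprime n r} := by
    have := card_le_card (filter_subset_filter (fun n => Nat.Coprime n r)
      (Icc_subset_Icc_right (a := 1) hn1))
    rw [card_coprime_Icc_mul] at this
    exact_mod_cast this
  have hc2 : (#{n ∈ Icc 1 ⌊y⌋₊ | Nat.Coprime n r} : ℝ) ≤ (q + 1) * r.totient := by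
    have := card_le_card (filter_subset_filter (fun n => Nat.Coprime n r)
      (Icc_subset_Icc_right (a := 1) hn2))
    rw [card_coprime_Icc_mul] at this
    exact_mod_cast this
  have hm1 : (q : ℝ) * r.totient ≤ y * (r.totient / r) := by
    have := mul_le_mul_of_nonneg_right hq1 (div_nonneg hφ hr0.le)
    calc (q : ℝ) * r.totient = q * r * (r.totient / r) := by field_simp
      _ ≤ _ := this
  have hm2 : y * (r.totient / r) ≤ ((q : ℝ) + 1) * r.totient := by
    have := mul_le_mul_of_nonneg_right hq2.le (div_nonneg hφ hr0.le)
    calc _ ≤ ((q : ℝ) + 1) * r * (r.totient / r) := this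
      _ = _ := by field_simp
  rw [abs_le]
  constructor <;> linarith

lemma sum_moebius_divisors (b : ℕ) :
    ∑ d ∈ b.divisors, ArithmeticFunction.moebius d = if b = 1 then 1 else 0 := by
  rw [← ArithmeticFunction.coe_mul_zeta_apply, ArithmeticFunction.moebius_mul_coe_zeta,
    ArithmeticFunction.one_apply]

lemma sq_dvd_sq_mul_squarefree_iff {a b d : ℕ} (ha : Squarefree a) (hb : b ≠ 0) :
    d ^ 2 ∣ b ^ 2 * a ↔ d ∣ b := by
  refine ⟨fun h => ?_, fun h => (pow_dvd_pow_of_dvd h 2).mul_right a⟩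
  obtain ⟨g, d', b', hg, hcop, rfl, rfl⟩ := Nat.exists_coprime' (m := d) (n := b)
    (Nat.gcd_pos_of_pos_right d (Nat.pos_of_ne_zero hb))
  have h' : d' ^ 2 ∣ b' ^ 2 * a := by
    refine Nat.dvd_of_mul_dvd_mul_right (pow_pos hg 2) ?_
    convert h using 1 <;> ring
  have hda : d' ^ 2 ∣ a := (Nat.Coprime.pow 2 2 hcop).dvd_of_dvd_mul_left h'
  have : d' = 1 := Nat.isUnit_iff.1 (ha d' (by rwa [← sq]))
  simp [this]

lemma moebius_sq_eq_sum {n D : ℕ} (hn : n ≠ 0) (hD : Nat.sqrt n ≤ D) :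
    ArithmeticFunction.moebius n ^ 2 =
      ∑ d ∈ Icc 1 D with d ^ 2 ∣ n, ArithmeticFunction.moebius d := by
  obtain ⟨a, b, rfl, ha⟩ := Nat.sq_mul_squarefree n
  have hb : b ≠ 0 := by rintro rfl; simp at hn
  have ha0 : a ≠ 0 := by rintro rfl; simp at hn
  have hfilter : {d ∈ Icc 1 D | d ^ 2 ∣ b ^ 2 * a} = b.divisors := by
    ext d
    simp only [mem_filter, mem_Icc, Nat.mem_divisors, sq_dvd_sq_mul_squarefree_iff ha hb]
    refine ⟨fun h => ⟨h.2, hb⟩, fun h => ⟨⟨Nat.pos_of_dvd_of_pos h.1 (Nat.pos_of_ne_zero hb), ?_⟩,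
      h.1⟩⟩
    refine (Nat.le_of_dvd (Nat.pos_of_ne_zero hb) h.1).trans (le_trans ?_ hD)
    rw [Nat.le_sqrt']
    exact Nat.le_mul_of_pos_right _ (Nat.pos_of_ne_zero ha0)
  rw [hfilter, sum_moebius_divisors, ArithmeticFunction.moebius_sq]
  refine if_congr ⟨fun h => ?_, ?_⟩ rfl rfl
  · exact Nat.isUnit_iff.1 (h b (by rw [← sq]; exact dvd_mul_right _ _))
  · rintro rfl; simpa using ha

lemma card_coprime_sq_dvd {r d : ℕ} (hd : d ≠ 0) (N : ℕ) :
    #{m ∈ Icc 1 N | Nat.Coprime m r ∧ d ^ 2 ∣ m} =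
      if Nat.Coprime d r then #{n ∈ Icc 1 (N / d ^ 2) | Nat.Coprime n r} else 0 := by
  have hd2 : 0 < d ^ 2 := by positivity
  split_ifs with h
  · symm
    refine card_bij (fun n _ => d ^ 2 * n) ?_ ?_ ?_
    · intro n hn
      simp only [mem_filter, mem_Icc] at hn ⊢
      refine ⟨⟨Nat.mul_pos hd2 hn.1.1, ?_⟩, (h.pow_left 2).mul_left hn.2, dvd_mul_right _ _⟩
      rw [mul_comm]; exact (Nat.le_div_iff_mul_le hd2).1 hn.1.2
    · intro a _ b _ hab
      exact Nat.eq_of_mul_eq_mul_left hd2 hab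
    · rintro m hm
      simp only [mem_filter, mem_Icc] at hm
      obtain ⟨⟨hm1, hmN⟩, hcop, n, rfl⟩ := hm
      refine ⟨n, ?_, rfl⟩
      simp only [mem_filter, mem_Icc]
      refine ⟨⟨Nat.pos_of_mul_pos_left hm1, ?_⟩, Nat.Coprime.of_dvd_left (dvd_mul_left _ _) hcop⟩
      rw [Nat.le_div_iff_mul_le hd2, mul_comm]; exact hmN
  · rw [card_eq_zero, filter_eq_empty_iff]
    rintro m - ⟨hcop, hdm⟩
    exact h (Nat.Coprime.of_dvd_left ((dvd_pow_self d two_ne_zero).trans hdm) hcop)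

lemma sum_moebius_sq_coprime (r N : ℕ) :
    ∑ m ∈ Icc 1 N with Nat.Coprime m r, ArithmeticFunction.moebius m ^ 2 =
      ∑ d ∈ Icc 1 N.sqrt with Nat.Coprime d r,
        ArithmeticFunction.moebius d * #{n ∈ Icc 1 (N / d ^ 2) | Nat.Coprime n r} := by
  calc _ = ∑ m ∈ Icc 1 N with Nat.Coprime m r, ∑ d ∈ Icc 1 N.sqrt,
        if d ^ 2 ∣ m then ArithmeticFunction.moebius d else 0 := by
        refine sum_congr rfl fun m hm => ?_
        simp only [mem_filter, mem_Icc] at hm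
        rw [moebius_sq_eq_sum (by omega) (Nat.sqrt_le_sqrt hm.1.2), sum_filter]
    _ = ∑ d ∈ Icc 1 N.sqrt,
        ArithmeticFunction.moebius d * #{m ∈ Icc 1 N | Nat.Coprime m r ∧ d ^ 2 ∣ m} := by
        rw [sum_comm]
        refine sum_congr rfl fun d _ => ?_
        rw [← sum_filter, filter_filter, sum_const, nsmul_eq_mul, mul_comm]
    _ = _ := by
        rw [sum_filter]
        refine sum_congr rfl fun d hd => ?_
        rw [card_coprime_sq_dvd (by simp at hd; omega)]
        split_ifs <;> simp

lemma hasSum_moebius_coprime_div_sq {r : ℕ} (hr : r ≠ 0) :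
    HasSum (fun d : ℕ => if Nat.Coprime d r then (ArithmeticFunction.moebius d : ℝ) / d ^ 2 else 0)
      (6 / (Real.pi ^ 2 * ∏ p ∈ r.primeFactors, (1 - ((p : ℝ) ^ 2)⁻¹))) := by
  have : NeZero r := ⟨hr⟩
  have hs : 1 < (2 : ℂ).re := by norm_num
  set χ : DirichletCharacter ℂ r := 1
  have hsum : LSeriesSummable ((fun n : ℕ => χ n) * fun n : ℕ => (ArithmeticFunction.moebius n : ℂ)) 2 :=
    DirichletCharacter.LSeriesSummable_mul χ
      (ArithmeticFunction.LSeriesSummable_moebius_iff.mpr hs)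
  have hone := DirichletCharacter.LSeries.mul_mu_eq_one χ hs
  have hL : LSeries (fun n : ℕ => χ n) 2 =
      (∏ p ∈ r.primeFactors, (1 - ((p : ℂ) ^ 2)⁻¹)) * ((Real.pi : ℂ) ^ 2 / 6) := by
    rw [← DirichletCharacter.LFunction_eq_LSeries χ hs]
    have := DirichletCharacter.LFunctionTrivChar_eq_mul_riemannZeta (N := r) (s := 2) (by norm_num)
    rw [riemannZeta_two] at this
    rw [← DirichletCharacter.LFunctionTrivChar, this]
    simp [Complex.cpow_neg]
  rw [← Complex.hasSum_ofReal]
  have h : HasSum (LSeries.term _ 2) _ := hsum.LSeriesHasSum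
  convert h using 1
  · ext d
    rcases eq_or_ne d 0 with rfl | hd
    · simp
    rw [LSeries.term_of_ne_zero hd]
    by_cases h : Nat.Coprime d r
    · have : χ (d : ZMod r) = 1 := MulChar.one_apply ((ZMod.isUnit_iff_coprime d r).2 h)
      rw [if_pos h]; simp [this]
    · have : χ (d : ZMod r) = 0 := MulChar.map_nonunit _ (mt (ZMod.isUnit_iff_coprime d r).1 h)
      rw [if_neg h]; simp [this]
  · rw [eq_comm, eq_div_of_mul_eq (left_ne_zero_of_mul_eq_one hone) ((mul_comm _ _).trans hone), hL]
    push_cast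
    rw [one_div, mul_inv, inv_div, div_mul_eq_div_div, mul_comm, ← div_eq_mul_inv]

lemma abs_sum_sub_le_of_hasSum {g : ℕ → ℝ} {A : ℝ} (hg : HasSum g A)
    (hle : ∀ d, |g d| ≤ ((d : ℝ) ^ 2)⁻¹) (D : ℕ) :
    |(∑ d ∈ Icc 1 D, g d) - A| ≤ 2 / (D + 1) := by
  have hg0 : g 0 = 0 := by simpa using hle 0
  have hD : ∑ d ∈ Icc 1 D, g d = ∑ d ∈ range (D + 1), g d := by
    rw [range_eq_Ico, sum_eq_sum_Ico_succ_bot (by omega), hg0, zero_add]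
    rfl
  rw [hD, abs_sub_comm]
  refine le_of_tendsto ((hg.tendsto_sum_nat.sub_const _).abs) ?_
  filter_upwards [Filter.eventually_ge_atTop (D + 1)] with n hn
  rw [← sum_Ico_eq_sub _ hn]
  calc _ ≤ ∑ d ∈ Ico (D + 1) n, |g d| := abs_sum_le_sum_abs _ _
    _ ≤ ∑ d ∈ Ico (D + 1) n, ((d : ℝ) ^ 2)⁻¹ := sum_le_sum fun d _ => hle d
    _ = ∑ d ∈ Ioo D n, ((d : ℝ) ^ 2)⁻¹ := rfl
    _ ≤ _ := sum_Ioo_inv_sq_le D n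

lemma totient_div_self_mul_density {r : ℕ} (hr : r ≠ 0) :
    (r.totient / r : ℝ) * (6 / (Real.pi ^ 2 * ∏ p ∈ r.primeFactors, (1 - ((p : ℝ) ^ 2)⁻¹))) =
      6 / (Real.pi ^ 2 * ∏ p ∈ r.primeFactors, (1 + 1 / (p : ℝ))) := by
  have hφ : (r.totient : ℝ) = r * ∏ p ∈ r.primeFactors, (1 - (p : ℝ)⁻¹) := by
    have := congrArg (fun q : ℚ => (q : ℝ)) (Nat.totient_eq_mul_prod_factors r)
    simpa using this
  have hprod : ∏ p ∈ r.primeFactors, (1 - ((p : ℝ) ^ 2)⁻¹) =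
      (∏ p ∈ r.primeFactors, (1 - (p : ℝ)⁻¹)) * ∏ p ∈ r.primeFactors, (1 + 1 / (p : ℝ)) := by
    rw [← prod_mul_distrib]
    refine prod_congr rfl fun p _ => ?_
    rw [one_div, ← inv_pow]; ring
  have h1 : ∏ p ∈ r.primeFactors, (1 - (p : ℝ)⁻¹) ≠ 0 := by
    refine prod_ne_zero_iff.2 fun p hp => ?_
    have : (1 : ℝ) < p := by exact_mod_cast (Nat.prime_of_mem_primeFactors hp).one_lt
    exact (sub_pos.2 (inv_lt_one_of_one_lt₀ this)).ne'
  have h2 : ∏ p ∈ r.primeFactors, (1 + 1 / (p : ℝ)) ≠ 0 :=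
    prod_ne_zero_iff.2 fun p _ => by positivity
  have hr' : (r : ℝ) ≠ 0 := by exact_mod_cast hr
  rw [hprod, hφ]
  generalize ∏ p ∈ r.primeFactors, (1 - (p : ℝ)⁻¹) = P at h1 ⊢
  generalize ∏ p ∈ r.primeFactors, (1 + 1 / (p : ℝ)) = Q at h2 ⊢
  field_simp

theorem stmt3 :
    ∃ C : ℝ, 0 < C ∧ ∀ r : ℕ, 1 ≤ r → ∀ x : ℝ, 1 ≤ x →
      |(∑ m ∈ (Finset.Icc 1 ⌊x⌋₊).filter (fun m => Nat.Coprime m r),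
          ((ArithmeticFunction.moebius m : ℝ)) ^ 2) -
        6 * x / (Real.pi ^ 2 * ∏ p ∈ r.primeFactors, (1 + 1 / (p : ℝ)))| ≤
      C * Real.sqrt x * (Nat.totient r : ℝ) := by
  refine ⟨3, by norm_num, fun r hr x hx => ?_⟩
  have hr0 : r ≠ 0 := by omega
  have hx0 : 0 < x := by linarith
  have hsx : 0 < √x := Real.sqrt_pos.2 hx0
  set N := ⌊x⌋₊ with hN
  set D := N.sqrt with hD
  set A := 6 / (Real.pi ^ 2 * ∏ p ∈ r.primeFactors, (1 - ((p : ℝ) ^ 2)⁻¹)) with hA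
  set g : ℕ → ℝ := fun d =>
    if Nat.Coprime d r then (ArithmeticFunction.moebius d : ℝ) / d ^ 2 else 0 with hg
  have hμ (d : ℕ) : |(ArithmeticFunction.moebius d : ℝ)| ≤ 1 := by
    exact_mod_cast ArithmeticFunction.abs_moebius_le_one
  have hDx : (D : ℝ) ≤ √x := by
    refine Real.le_sqrt_of_sq_le ?_
    have : D ^ 2 ≤ N := Nat.sqrt_le' N
    exact le_trans (by exact_mod_cast this) (Nat.floor_le hx0.le)
  have hxD : √x ≤ D + 1 := by
    refine Real.sqrt_le_iff.2 ⟨by positivity, ?_⟩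
    have h1 : N + 1 ≤ (D + 1) ^ 2 := Nat.lt_succ_sqrt' N
    have h2 : x < N + 1 := Nat.lt_floor_add_one x
    exact h2.le.trans (by exact_mod_cast h1)
  have htail : |(∑ d ∈ Icc 1 D, g d) - A| ≤ 2 / √x := by
    refine (abs_sum_sub_le_of_hasSum (hasSum_moebius_coprime_div_sq hr0) (fun d => ?_) D).trans
      (div_le_div_of_nonneg_left zero_le_two hsx hxD)
    split_ifs
    · rw [abs_div, abs_of_nonneg (by positivity : (0 : ℝ) ≤ (d : ℝ) ^ 2), div_eq_mul_inv]
      exact mul_le_of_le_one_left (by positivity) (hμ d)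
    · simp
  have hS : (∑ m ∈ Icc 1 N with Nat.Coprime m r, (ArithmeticFunction.moebius m : ℝ) ^ 2) =
      ∑ d ∈ Icc 1 D with Nat.Coprime d r, (ArithmeticFunction.moebius d : ℝ) *
        #{n ∈ Icc 1 ⌊x / (d : ℝ) ^ 2⌋₊ | Nat.Coprime n r} := by
    have := congrArg (fun z : ℤ => (z : ℝ)) (sum_moebius_sq_coprime r N)
    push_cast at this
    rw [this]
    refine sum_congr rfl fun d _ => ?_
    rw [← Nat.cast_pow, Nat.floor_div_natCast]
  have hmain : |(∑ m ∈ Icc 1 N with Nat.Coprime m r, (ArithmeticFunction.moebius m : ℝ) ^ 2) -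
      x * (r.totient / r) * ∑ d ∈ Icc 1 D, g d| ≤ D * r.totient := by
    rw [hS, hg, ← sum_filter, mul_sum, ← sum_sub_distrib]
    calc _ ≤ ∑ d ∈ Icc 1 D with Nat.Coprime d r, (r.totient : ℝ) := by
          refine (abs_sum_le_sum_abs _ _).trans (sum_le_sum fun d _ => ?_)
          have h := abs_card_coprime_sub_le hr (y := x / (d : ℝ) ^ 2) (by positivity)
          calc _ = |(ArithmeticFunction.moebius d : ℝ)| *
                |(#{n ∈ Icc 1 ⌊x / (d : ℝ) ^ 2⌋₊ | Nat.Coprime n r} : ℝ) -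
                  x / (d : ℝ) ^ 2 * (r.totient / r)| := by rw [← abs_mul]; congr 1; ring
            _ ≤ 1 * r.totient := mul_le_mul (hμ d) h (abs_nonneg _) zero_le_one
            _ = _ := one_mul _
      _ ≤ ∑ d ∈ Icc 1 D, (r.totient : ℝ) :=
          sum_le_sum_of_subset_of_nonneg (filter_subset _ _) fun _ _ _ => by positivity
      _ = _ := by simp
  have htarget : 6 * x / (Real.pi ^ 2 * ∏ p ∈ r.primeFactors, (1 + 1 / (p : ℝ))) =
      x * (r.totient / r) * A := by
    rw [mul_assoc, totient_div_self_mul_density hr0]; ring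
  have hratio : (r.totient / r : ℝ) ≤ r.totient :=
    div_le_self (by positivity) (by exact_mod_cast hr)
  have herr : |x * (r.totient / r) * (∑ d ∈ Icc 1 D, g d) - x * (r.totient / r) * A| ≤
      2 * √x * r.totient := by
    rw [← mul_sub, abs_mul, abs_of_nonneg (by positivity : (0 : ℝ) ≤ x * (r.totient / r))]
    calc _ ≤ x * r.totient * (2 / √x) := by gcongr
      _ = 2 * (x / √x) * r.totient := by ring
      _ = _ := by rw [Real.div_sqrt]
  rw [htarget]
  calc _ ≤ _ := abs_sub_le _ (x * (r.totient / r) * ∑ d ∈ Icc 1 D, g d) _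
    _ ≤ D * r.totient + 2 * √x * r.totient := add_le_add hmain herr
    _ ≤ √x * r.totient + 2 * √x * r.totient := by gcongr
    _ = _ := by ring
end

section
/- For every fixed integer r ≥ 1, Σ_{m ≤ x, gcd(m,r)=1} μ(m) = o(x) as x → ∞; that is, (1/x) Σ_{m ≤ x, gcd(m,r)=1} μ(m) tends to 0 as x → ∞. -/
open Filter

section MeanValue

open Real FourierTransform MeasureTheory Topology

/-- The normalised summatory function `e⁻ᵘ ∑_{k ≤ eᵘ} a k` in logarithmic scale. -/
noncomputable def logMean (a : ℕ → ℂ) (u : ℝ) : ℂ :=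
  (∑ k ∈ Finset.Icc 1 ⌊exp u⌋₊, a k) * (exp (-u) : ℝ)

section LogMean

variable {a : ℕ → ℂ}

theorem norm_sum_Ioc_le (ha : ∀ n, ‖a n‖ ≤ 1) (m n : ℕ) :
    ‖∑ k ∈ Finset.Ioc m n, a k‖ ≤ (n - m : ℕ) := by
  simpa using norm_sum_le_of_le (Finset.Ioc m n) fun k _ => ha k

theorem norm_sum_Icc_floor_le (ha : ∀ n, ‖a n‖ ≤ 1) (u : ℝ) :
    ‖∑ k ∈ Finset.Icc 1 ⌊exp u⌋₊, a k‖ ≤ exp u := by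
  have h := norm_sum_le_of_le (Finset.Icc 1 ⌊exp u⌋₊) fun k _ => ha k
  simp only [Finset.sum_const, Nat.card_Icc, add_tsub_cancel_right, nsmul_eq_mul, mul_one] at h
  exact h.trans (Nat.floor_le (exp_pos u).le)

theorem norm_logMean_le_one (ha : ∀ n, ‖a n‖ ≤ 1) (u : ℝ) : ‖logMean a u‖ ≤ 1 := by
  rw [logMean, norm_mul, Complex.norm_real, norm_of_nonneg (exp_pos _).le]
  calc _ ≤ exp u * exp (-u) := by gcongr; exact norm_sum_Icc_floor_le ha u
    _ = 1 := by rw [← exp_add]; simp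

theorem measurable_logMean : Measurable (logMean a) := by
  have h : Measurable fun n : ℕ => ∑ k ∈ Finset.Icc 1 n, a k := measurable_from_nat
  exact (h.comp (Nat.measurable_floor.comp measurable_exp)).mul
    (Complex.measurable_ofReal.comp (measurable_exp.comp measurable_neg))

theorem logMean_of_neg {u : ℝ} (hu : u < 0) : logMean a u = 0 := by
  have : ⌊exp u⌋₊ = 0 := Nat.floor_eq_zero.2 (by simpa using hu)
  simp [logMean, this]

theorem norm_logMean_sub_le_of_le (ha : ∀ n, ‖a n‖ ≤ 1) {u v : ℝ} (huv : u ≤ v) :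
    ‖logMean a v - logMean a u‖ ≤ 2 * (v - u) + exp (-u) := by
  have hfl : ⌊exp u⌋₊ ≤ ⌊exp v⌋₊ := Nat.floor_mono (exp_le_exp.2 huv)
  have hS : ∑ k ∈ Finset.Icc 1 ⌊exp v⌋₊, a k = ∑ k ∈ Finset.Icc 1 ⌊exp u⌋₊, a k +
      ∑ k ∈ Finset.Ioc ⌊exp u⌋₊ ⌊exp v⌋₊, a k := by
    have h (n : ℕ) : Finset.Icc 1 n = Finset.Ioc 0 n := rfl
    rw [h, h, Finset.sum_Ioc_consecutive _ (Nat.zero_le _) hfl]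
  have hT : ‖∑ k ∈ Finset.Ioc ⌊exp u⌋₊ ⌊exp v⌋₊, a k‖ ≤ exp v - exp u + 1 := by
    refine (norm_sum_Ioc_le ha _ _).trans ?_
    rw [Nat.cast_sub hfl]
    linarith [Nat.floor_le (exp_pos v).le, Nat.lt_floor_add_one (exp u)]
  have hd : logMean a v - logMean a u =
      (∑ k ∈ Finset.Ioc ⌊exp u⌋₊ ⌊exp v⌋₊, a k) * (exp (-v) : ℝ) -
        (∑ k ∈ Finset.Icc 1 ⌊exp u⌋₊, a k) * ((exp (-u) - exp (-v) : ℝ) : ℂ) := by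
    rw [logMean, logMean, hS]; push_cast; ring
  have hle : exp (-v) ≤ exp (-u) := exp_le_exp.2 (by linarith)
  have hb : 1 - (v - u) ≤ exp (u - v) := by linarith [add_one_le_exp (u - v)]
  calc _ ≤ (exp v - exp u + 1) * exp (-v) + exp u * (exp (-u) - exp (-v)) := by
        rw [hd]
        refine (norm_sub_le _ _).trans ?_
        rw [norm_mul, norm_mul, Complex.norm_real, Complex.norm_real,
          norm_of_nonneg (exp_pos _).le, norm_of_nonneg (sub_nonneg.2 hle)]
        exact add_le_add (mul_le_mul_of_nonneg_right hT (exp_pos _).le)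
          (mul_le_mul_of_nonneg_right (norm_sum_Icc_floor_le ha u) (sub_nonneg.2 hle))
    _ = 2 * (1 - exp (u - v)) + exp (-v) := by
        simp only [sub_eq_add_neg u v, exp_add]
        have h1 : exp v * exp (-v) = 1 := by rw [← exp_add]; simp
        have h2 : exp u * exp (-u) = 1 := by rw [← exp_add]; simp
        linear_combination h1 + h2
    _ ≤ _ := by linarith

theorem norm_logMean_add_sub_le (ha : ∀ n, ‖a n‖ ≤ 1) {y : ℝ} (hy : 2 ≤ y) (v : ℝ) :
    ‖logMean a (y + v) - logMean a y‖ ≤ 2 * |v| + exp (-(y / 2)) := by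
  rcases le_total 0 v with hv | hv
  · have h := norm_logMean_sub_le_of_le ha (u := y) (v := y + v) (by linarith)
    have : exp (-y) ≤ exp (-(y / 2)) := exp_le_exp.2 (by linarith)
    rw [abs_of_nonneg hv]
    linarith
  rw [abs_of_nonpos hv]
  rcases le_total (-v) (y / 2) with hvy | hvy
  · have h := norm_logMean_sub_le_of_le ha (u := y + v) (v := y) (by linarith)
    have : exp (-(y + v)) ≤ exp (-(y / 2)) := exp_le_exp.2 (by linarith)
    rw [norm_sub_rev]
    linarith
  · have h := norm_sub_le (logMean a (y + v)) (logMean a y)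
    linarith [norm_logMean_le_one ha (y + v), norm_logMean_le_one ha y, exp_pos (-(y / 2))]

theorem integrable_exp_mul_logMean (ha : ∀ n, ‖a n‖ ≤ 1) {δ : ℝ} (hδ : 0 < δ) :
    Integrable fun u : ℝ => ((exp (-δ * u) : ℝ) : ℂ) * logMean a u := by
  have h : Integrable (Set.indicator (Set.Ici 0) fun u : ℝ => exp (-δ * u)) :=
    (integrable_indicator_iff measurableSet_Ici).2
      ((integrableOn_Ici_iff_integrableOn_Ioi).2 (exp_neg_integrableOn_Ioi 0 hδ))
  refine h.mono' (by have := measurable_logMean (a := a); fun_prop) (.of_forall fun u => ?_)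
  rcases lt_or_ge u 0 with hu | hu
  · simp [logMean_of_neg hu, hu]
  · rw [Set.indicator_of_mem (Set.mem_Ici.2 hu), norm_mul, Complex.norm_real,
      norm_of_nonneg (exp_pos _).le]
    exact mul_le_of_le_one_right (exp_pos _).le (norm_logMean_le_one ha u)

theorem fourier_exp_mul_logMean (ha : ∀ n, ‖a n‖ ≤ 1) {δ : ℝ} (hδ : 0 < δ) (ξ : ℝ) :
    𝓕 (fun u : ℝ => ((exp (-δ * u) : ℝ) : ℂ) * logMean a u) ξ =
      LSeries a (1 + δ + 2 * π * ξ * Complex.I) / (1 + δ + 2 * π * ξ * Complex.I) := by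
  set s : ℂ := 1 + δ + 2 * π * ξ * Complex.I with hs
  have hre : s.re = 1 + δ := by simp [hs]
  have hs0 : s ≠ 0 := fun h => by rw [h, Complex.zero_re] at hre; linarith
  have hO : (fun n : ℕ => ∑ k ∈ Finset.Icc 1 n, ‖a k‖) =O[atTop] fun n => (n : ℝ) ^ (1 : ℝ) := by
    refine Asymptotics.isBigO_of_le _ fun n => ?_
    rw [norm_of_nonneg (Finset.sum_nonneg fun _ _ => norm_nonneg _), rpow_one, Real.norm_natCast]
    simpa using Finset.sum_le_sum fun k (_ : k ∈ Finset.Icc 1 n) => ha k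
  rw [LSeries_eq_mul_integral' a zero_le_one (by rw [hre]; linarith) hO,
    mul_div_cancel_left₀ _ hs0, ← integral_Ici_eq_integral_Ioi]
  have himg : exp '' Set.Ici 0 = Set.Ici 1 := by
    ext t
    simp only [Set.mem_image, Set.mem_Ici]
    refine ⟨?_, fun ht => ⟨log t, log_nonneg ht, exp_log (by linarith)⟩⟩
    rintro ⟨u, hu, rfl⟩
    exact one_le_exp hu
  rw [← himg, integral_image_eq_integral_abs_deriv_smul measurableSet_Ici
    (fun u _ => (hasDerivAt_exp u).hasDerivWithinAt) exp_injective.injOn, fourier_real_eq]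
  rw [← setIntegral_eq_integral_of_forall_compl_eq_zero (s := Set.Ici 0) fun u hu => by
    rw [logMean_of_neg (not_le.1 hu)]; simp]
  refine setIntegral_congr_fun measurableSet_Ici fun u _ => ?_
  have hcpow : ((exp u : ℝ) : ℂ) ^ (-(s + 1)) = Complex.exp (u * -(s + 1)) := by
    rw [Complex.cpow_def_of_ne_zero (by exact_mod_cast (exp_pos u).ne'), Complex.ofReal_exp,
      ← Complex.ofReal_exp, ← Complex.ofReal_log (exp_pos u).le, log_exp]
  rw [Complex.ofReal_exp] at hcpow
  simp only [abs_of_pos (exp_pos u), logMean, Circle.smul_def, Real.fourierChar_apply,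
    smul_eq_mul, Complex.real_smul, Complex.ofReal_exp]
  rw [hcpow]
  have h1 : Complex.exp (u * -(s + 1)) * Complex.exp u =
      Complex.exp (↑(2 * π * -(u * ξ)) * Complex.I) *
        Complex.exp ↑(-δ * u) * Complex.exp ↑(-u) := by
    rw [← Complex.exp_add, ← Complex.exp_add, ← Complex.exp_add, hs]
    congr 1
    push_cast
    ring
  linear_combination -(∑ k ∈ Finset.Icc 1 ⌊exp u⌋₊, a k) * h1


theorem fourier_fourierChar_smul (φ : ℝ → ℂ) (y u : ℝ) :
    𝓕 (fun ξ : ℝ => 𝐞 (ξ * y) • φ ξ) u = 𝓕 φ (u - y) := by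
  rw [fourier_real_eq, fourier_real_eq]
  refine integral_congr_ae (.of_forall fun ξ => ?_)
  simp only [smul_smul, ← AddChar.map_add_eq_mul]
  ring_nf

theorem integral_fourier_mul_eq_integral_mul_fourier {f g : ℝ → ℂ} (hf : Integrable f)
    (hg : Integrable g) : ∫ ξ, 𝓕 f ξ * g ξ = ∫ x, f x * 𝓕 g x := by
  have h := VectorFourier.integral_fourierIntegral_smul_eq_flip (L := innerₗ ℝ)
    Real.continuous_fourierChar (by exact continuous_inner) hf hg
  rw [flip_innerₗ] at h
  exact h

theorem continuousOn_vertical_lines {H : ℂ → ℂ} (hH : ContinuousOn H {s | 1 ≤ s.re}) :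
    ContinuousOn (fun p : ℝ × ℝ => H (1 + p.1 + 2 * π * p.2 * Complex.I))
      {p | 0 ≤ p.1} :=
  hH.comp (by fun_prop) fun p hp => by simpa using hp

theorem integral_logMean_mul_fourier (ha : ∀ n, ‖a n‖ ≤ 1) {H : ℂ → ℂ}
    (hH : ContinuousOn H {s | 1 ≤ s.re}) (hL : ∀ s : ℂ, 1 < s.re → LSeries a s / s = H s)
    {φ : ℝ → ℂ} (hφ : Continuous φ) (hφc : HasCompactSupport φ) (hφi : Integrable (𝓕 φ)) (y : ℝ) :
    ∫ u, logMean a u * 𝓕 φ (u - y) =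
      𝓕 (fun ξ : ℝ => H (1 + 2 * π * ξ * Complex.I) * φ ξ) (-y) := by
  have hφy : Integrable fun ξ : ℝ => 𝐞 (ξ * y) • φ ξ :=
    (by fun_prop : Continuous fun ξ : ℝ => 𝐞 (ξ * y) • φ ξ).integrable_of_hasCompactSupport
      (hφc.mono fun ξ hξ h => hξ (by simp [h]))
  have hcont := continuousOn_vertical_lines hH
  have hpos : ∀ᶠ δ : ℝ in 𝓝[>] 0, 0 < δ := self_mem_nhdsWithin
  have hlt : ∀ᶠ δ : ℝ in 𝓝[>] 0, δ < 1 := nhdsWithin_le_nhds (Iio_mem_nhds one_pos)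
  have hδ0 : Tendsto (fun δ : ℝ => δ) (𝓝[>] 0) (𝓝 0) := nhdsWithin_le_nhds
  have key : ∀ δ : ℝ, 0 < δ → ∫ u, ((exp (-δ * u) : ℝ) : ℂ) * logMean a u * 𝓕 φ (u - y) =
      ∫ ξ : ℝ, H (1 + δ + 2 * π * ξ * Complex.I) * (𝐞 (ξ * y) • φ ξ) := by
    intro δ hδ
    have h := integral_fourier_mul_eq_integral_mul_fourier (integrable_exp_mul_logMean ha hδ) hφy
    simp only [fourier_fourierChar_smul, fourier_exp_mul_logMean ha hδ] at h
    rw [← h]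
    refine integral_congr_ae (.of_forall fun ξ => ?_)
    simp only
    rw [hL _ (by simpa using hδ)]
  have hleft : Tendsto (fun δ : ℝ => ∫ u, ((exp (-δ * u) : ℝ) : ℂ) * logMean a u * 𝓕 φ (u - y))
      (𝓝[>] 0) (𝓝 (∫ u, logMean a u * 𝓕 φ (u - y))) := by
    have hi := hφi.comp_sub_right y
    refine tendsto_integral_filter_of_dominated_convergence (fun u => ‖𝓕 φ (u - y)‖)
      (.of_forall fun δ => ?_) ?_ hi.norm (.of_forall fun u => ?_)
    · have := measurable_logMean (a := a)
      exact (by fun_prop : Measurable fun u : ℝ =>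
        ((exp (-δ * u) : ℝ) : ℂ) * logMean a u).aestronglyMeasurable.mul hi.aestronglyMeasurable
    · filter_upwards [hpos] with δ hδ
      refine .of_forall fun u => ?_
      rcases lt_or_ge u 0 with hu | hu
      · simp [logMean_of_neg hu]
      · rw [norm_mul, norm_mul, Complex.norm_real, norm_of_nonneg (exp_pos _).le]
        have h1 : exp (-δ * u) ≤ 1 := exp_le_one_iff.2 (by nlinarith)
        exact mul_le_of_le_one_left (norm_nonneg _)
          (mul_le_one₀ h1 (norm_nonneg _) (norm_logMean_le_one ha u))
    · have h1 : Tendsto (fun δ : ℝ => ((exp (-δ * u) : ℝ) : ℂ)) (𝓝[>] 0) (𝓝 1) := by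
        have : Continuous fun δ : ℝ => ((exp (-δ * u) : ℝ) : ℂ) := by fun_prop
        simpa using (this.tendsto 0).mono_left nhdsWithin_le_nhds
      simpa using (h1.mul_const (logMean a u)).mul_const (𝓕 φ (u - y))
  have hright : Tendsto (fun δ : ℝ => ∫ ξ : ℝ, H (1 + δ + 2 * π * ξ * Complex.I) *
      (𝐞 (ξ * y) • φ ξ)) (𝓝[>] 0)
      (𝓝 (∫ ξ : ℝ, H (1 + 2 * π * ξ * Complex.I) * (𝐞 (ξ * y) • φ ξ))) := by
    obtain ⟨C, hC⟩ := ((isCompact_Icc (a := (0 : ℝ)) (b := 1)).prod hφc).exists_bound_of_continuousOn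
      (hcont.mono fun p hp => hp.1.1)
    refine tendsto_integral_filter_of_dominated_convergence (fun ξ => C * ‖𝐞 (ξ * y) • φ ξ‖)
      ?_ ?_ (hφy.norm.const_mul C) (.of_forall fun ξ => ?_)
    · filter_upwards [hpos] with δ hδ
      have : Continuous fun ξ : ℝ => H (1 + δ + 2 * π * ξ * Complex.I) :=
        continuousOn_univ.1 (hcont.comp (f := fun ξ : ℝ => (δ, ξ)) (by fun_prop)
          fun _ _ => hδ.le)
      exact this.aestronglyMeasurable.mul hφy.aestronglyMeasurable
    · filter_upwards [hpos, hlt] with δ hδ hδ1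
      refine .of_forall fun ξ => ?_
      by_cases hξ : ξ ∈ tsupport φ
      · rw [norm_mul]
        gcongr
        exact hC (δ, ξ) ⟨⟨hδ.le, hδ1.le⟩, hξ⟩
      · simp [image_eq_zero_of_notMem_tsupport hξ]
    · refine Tendsto.mul_const _ ?_
      have h0 := hcont (0, ξ) (Set.mem_ofPred.2 le_rfl)
      have h1 : Tendsto (fun δ : ℝ => (δ, ξ)) (𝓝[>] 0) (𝓝[{p | 0 ≤ p.1}] ((0 : ℝ), ξ)) :=
        tendsto_nhdsWithin_iff.2
          ⟨hδ0.prodMk_nhds tendsto_const_nhds, hpos.mono fun _ h => Set.mem_ofPred.2 h.le⟩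
      simpa [Function.comp_def] using h0.tendsto.comp h1
  have h := tendsto_nhds_unique (hleft.congr' (hpos.mono key)) hright
  rw [h, fourier_real_eq]
  refine integral_congr_ae (.of_forall fun ξ => ?_)
  simp [Circle.smul_def]
  ring

theorem tendsto_integral_logMean_mul_fourier (ha : ∀ n, ‖a n‖ ≤ 1) {H : ℂ → ℂ}
    (hH : ContinuousOn H {s | 1 ≤ s.re}) (hL : ∀ s : ℂ, 1 < s.re → LSeries a s / s = H s)
    {φ : ℝ → ℂ} (hφ : Continuous φ) (hφc : HasCompactSupport φ) (hφi : Integrable (𝓕 φ)) :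
    Tendsto (fun y : ℝ => ∫ u, logMean a u * 𝓕 φ (u - y)) atTop (𝓝 0) := by
  simp_rw [integral_logMean_mul_fourier ha hH hL hφ hφc hφi]
  exact (Real.zero_at_infty_fourier _).comp
    (tendsto_neg_atTop_atBot.mono_right atBot_le_cocompact)

end LogMean

/-- Band-limited approximate identities: kernels of integral one whose Fourier transform has compact
support and whose first absolute moment is arbitrarily small. -/
theorem exists_bandlimited_kernel {ε : ℝ} (hε : 0 < ε) :
    ∃ φ : ℝ → ℂ, Continuous φ ∧ HasCompactSupport φ ∧ Integrable (𝓕 φ) ∧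
      Integrable (fun v => |v| * ‖𝓕 φ v‖) ∧ ∫ v, 𝓕 φ v = 1 ∧ ∫ v, |v| * ‖𝓕 φ v‖ ≤ ε := by
  let b : ContDiffBump (0 : ℝ) := ⟨1, 2, one_pos, one_lt_two⟩
  have hbc : HasCompactSupport fun t : ℝ => (b t : ℂ) :=
    b.hasCompactSupport.comp_left Complex.ofReal_zero
  let ψ : SchwartzMap ℝ ℂ := hbc.toSchwartzMap (Complex.ofRealCLM.contDiff.comp b.contDiff)
  have hψc : HasCompactSupport ψ := hbc
  have hψ0 : ψ 0 = 1 := by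
    change ((b 0 : ℝ) : ℂ) = 1
    rw [b.one_of_mem_closedBall (Metric.mem_closedBall_self b.rIn_pos.le), Complex.ofReal_one]
  have hint : Integrable (𝓕 (ψ : ℝ → ℂ)) := by
    rw [← SchwartzMap.fourier_coe]; exact SchwartzMap.integrable _
  have hmom : Integrable fun v => |v| * ‖𝓕 (ψ : ℝ → ℂ) v‖ := by
    have h := (𝓕 ψ).integrable_pow_mul volume 1
    simp only [pow_one, Real.norm_eq_abs, SchwartzMap.fourier_coe] at h
    exact h
  have hone : ∫ v, 𝓕 (ψ : ℝ → ℂ) v = 1 := by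
    have h := congrFun (ψ.continuous.fourierInv_fourier_eq ψ.integrable hint) 0
    rw [fourierInv_eq] at h
    simpa [hψ0] using h
  set C := ∫ v, |v| * ‖𝓕 (ψ : ℝ → ℂ) v‖ with hCdef
  have hC : 0 ≤ C := integral_nonneg fun v => by positivity
  obtain ⟨l, hl, hlC⟩ : ∃ l : ℝ, 0 < l ∧ l⁻¹ * C ≤ ε := by
    refine ⟨(C + 1) / ε, by positivity, ?_⟩
    rw [inv_div, div_mul_eq_mul_div, div_le_iff₀ (by positivity)]
    nlinarith
  have hscale (v : ℝ) : 𝓕 (fun t : ℝ => ψ (l⁻¹ * t)) v = l * 𝓕 (ψ : ℝ → ℂ) (l * v) := by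
    rw [fourier_real_eq, fourier_real_eq]
    have h := Measure.integral_comp_mul_left (fun t : ℝ => 𝐞 (-(t * (l * v))) • ψ t) l⁻¹
    rw [inv_inv, abs_of_pos hl, Complex.real_smul] at h
    rw [← h]
    refine integral_congr_ae (.of_forall fun t => ?_)
    have : l⁻¹ * t * (l * v) = t * v := by field_simp
    simp only [this]
  have hmeq (v : ℝ) : |v| * ‖(l : ℂ) * 𝓕 (ψ : ℝ → ℂ) (l * v)‖ =
      |l * v| * ‖𝓕 (ψ : ℝ → ℂ) (l * v)‖ := by
    rw [norm_mul, Complex.norm_real, norm_eq_abs, abs_mul]; ring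
  refine ⟨fun t => ψ (l⁻¹ * t), by fun_prop, ?_, ?_, ?_, ?_, ?_⟩
  · exact hψc.comp_homeomorph (Homeomorph.mulLeft₀ l⁻¹ (inv_ne_zero hl.ne'))
  · simp_rw [funext hscale]
    exact (hint.comp_mul_left' hl.ne').const_mul _
  · simp_rw [hscale, hmeq]
    exact hmom.comp_mul_left' hl.ne'
  · simp_rw [hscale]
    rw [integral_const_mul, Measure.integral_comp_mul_left (𝓕 (ψ : ℝ → ℂ)) l, hone,
      abs_of_pos (inv_pos.2 hl)]
    simp [hl.ne']
  · simp_rw [hscale, hmeq]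
    rw [Measure.integral_comp_mul_left (fun v => |v| * ‖𝓕 (ψ : ℝ → ℂ) v‖) l,
      abs_of_pos (inv_pos.2 hl), smul_eq_mul]
    exact hlC

theorem tendsto_logMean {a : ℕ → ℂ} (ha : ∀ n, ‖a n‖ ≤ 1) {H : ℂ → ℂ}
    (hH : ContinuousOn H {s | 1 ≤ s.re}) (hL : ∀ s : ℂ, 1 < s.re → LSeries a s / s = H s) :
    Tendsto (logMean a) atTop (𝓝 0) := by
  rw [NormedAddGroup.tendsto_nhds_zero]
  intro ε hε
  obtain ⟨φ, hφ, hφc, hφi, hφm, hφ1, hφε⟩ := exists_bandlimited_kernel (ε := ε / 8) (by linarith)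
  have hconv := NormedAddGroup.tendsto_nhds_zero.1
    (tendsto_integral_logMean_mul_fourier ha hH hL hφ hφc hφi) (ε / 4) (by linarith)
  have hexp : Tendsto (fun y : ℝ => exp (-(y / 2)) * ∫ v, ‖𝓕 φ v‖) atTop (𝓝 0) := by
    simpa using (tendsto_exp_neg_atTop_nhds_zero.comp
      (tendsto_id.atTop_div_const two_pos)).mul_const (∫ v, ‖𝓕 φ v‖)
  filter_upwards [hconv, hexp.eventually_lt_const (by linarith : 0 < ε / 4),
    eventually_ge_atTop 2] with y hy hye hy2
  have hshift : ∫ u, logMean a u * 𝓕 φ (u - y) = ∫ v, logMean a (y + v) * 𝓕 φ v := by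
    rw [← integral_add_left_eq_self _ y]
    simp
  have hbound (v : ℝ) : ‖logMean a (y + v) * 𝓕 φ v‖ ≤ ‖𝓕 φ v‖ := by
    rw [norm_mul]
    exact mul_le_of_le_one_left (norm_nonneg _) (norm_logMean_le_one ha _)
  have hint : Integrable fun v => logMean a (y + v) * 𝓕 φ v :=
    hφi.norm.mono' ((measurable_logMean.comp
      (measurable_const_add y)).aestronglyMeasurable.mul hφi.aestronglyMeasurable)
      (.of_forall hbound)
  have hdiff : ‖(∫ u, logMean a u * 𝓕 φ (u - y)) - logMean a y‖ ≤
      2 * (ε / 8) + exp (-(y / 2)) * ∫ v, ‖𝓕 φ v‖ := by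
    calc _ = ‖∫ v, (logMean a (y + v) * 𝓕 φ v - logMean a y * 𝓕 φ v)‖ := by
          rw [integral_sub hint (hφi.const_mul _), integral_const_mul, hφ1, mul_one, hshift]
      _ ≤ ∫ v, (2 * (|v| * ‖𝓕 φ v‖) + exp (-(y / 2)) * ‖𝓕 φ v‖) := by
          refine norm_integral_le_of_norm_le
            ((hφm.const_mul 2).add (hφi.norm.const_mul _)) (.of_forall fun v => ?_)
          rw [← sub_mul, norm_mul, ← mul_assoc, ← add_mul]
          gcongr
          exact norm_logMean_add_sub_le ha hy2 v
      _ = 2 * (∫ v, |v| * ‖𝓕 φ v‖) + exp (-(y / 2)) * ∫ v, ‖𝓕 φ v‖ := by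
          rw [integral_add (hφm.const_mul 2) (hφi.norm.const_mul _), integral_const_mul,
            integral_const_mul]
      _ ≤ _ := by gcongr
  have htri := norm_sub_norm_le (logMean a y) (∫ u, logMean a u * 𝓕 φ (u - y))
  rw [norm_sub_rev] at htri
  linarith

/-- A Wiener–Ikehara type theorem for bounded coefficients: if the Dirichlet series of a sequence
bounded by one extends continuously to the closed half-plane `1 ≤ re s`, then the sequence has mean
value zero. -/
theorem tendsto_sum_div_of_LSeries_eq {a : ℕ → ℂ} (ha : ∀ n, ‖a n‖ ≤ 1) {F : ℂ → ℂ}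
    (hF : ContinuousOn F {s | 1 ≤ s.re}) (hL : ∀ s : ℂ, 1 < s.re → LSeries a s = F s) :
    Tendsto (fun x : ℝ => (∑ k ∈ Finset.Icc 1 ⌊x⌋₊, a k) / x) atTop (𝓝 0) := by
  have hH : ContinuousOn (fun s => F s / s) {s | 1 ≤ s.re} :=
    hF.div continuousOn_id fun s hs h => by
      change s = 0 at h
      rw [Set.mem_ofPred, h, Complex.zero_re] at hs
      linarith
  refine ((tendsto_logMean ha hH fun s hs => by rw [hL s hs]).comp tendsto_log_atTop).congr' ?_
  filter_upwards [eventually_gt_atTop 0] with x hx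
  simp [logMean, exp_neg, exp_log hx, div_eq_mul_inv]

open DirichletCharacter ArithmeticFunction in
theorem tendsto_sum_trivialCharacter_mul_moebius (r : ℕ) [NeZero r] :
    Tendsto (fun x : ℝ => (∑ k ∈ Finset.Icc 1 ⌊x⌋₊,
      (1 : DirichletCharacter ℂ r) k * (moebius k : ℂ)) / x) atTop (𝓝 0) := by
  have hne : ∀ s ∈ {s : ℂ | 1 ≤ s.re}, LFunctionTrivChar₁ r s ≠ 0 := fun s hs => by
    rcases eq_or_ne s 1 with rfl | h1
    · exact LFunctionTrivChar₁_apply_one_ne_zero r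
    · rw [LFunctionTrivChar₁, Function.update_of_ne h1]
      exact mul_ne_zero (sub_ne_zero_of_ne h1) (LFunction_ne_zero_of_one_le_re 1 (.inr h1) hs)
  refine tendsto_sum_div_of_LSeries_eq (F := fun s => (s - 1) / LFunctionTrivChar₁ r s)
    (fun n => ?_) ?_ fun s hs => ?_
  · rw [norm_mul]
    refine mul_le_one₀ (DirichletCharacter.norm_le_one _ _) (norm_nonneg _) ?_
    rw [Complex.norm_intCast]
    exact_mod_cast abs_moebius_le_one
  · exact (by fun_prop : Continuous fun s : ℂ => s - 1).continuousOn.div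
      (differentiable_LFunctionTrivChar₁ r).continuous.continuousOn hne
  · have h1 : s ≠ 1 := fun h => by simp [h] at hs
    have h := LSeries.mul_mu_eq_one (1 : DirichletCharacter ℂ r) hs
    rw [← LFunction_eq_LSeries _ hs] at h
    rw [LFunctionTrivChar₁, Function.update_of_ne h1, LFunctionTrivChar,
      div_mul_cancel_left₀ (sub_ne_zero_of_ne h1)]
    exact eq_inv_of_mul_eq_one_right h

end MeanValue

theorem stmt4 (r : ℕ) (hr : 1 ≤ r) :
    Tendsto (fun x : ℝ =>
        (∑ m ∈ (Finset.Icc 1 ⌊x⌋₊).filter (fun m => Nat.Coprime m r),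
          ((ArithmeticFunction.moebius m : ℝ))) / x)
      atTop (nhds 0) := by
  have : NeZero r := ⟨by omega⟩
  have h := (Complex.continuous_re.tendsto 0).comp (tendsto_sum_trivialCharacter_mul_moebius r)
  rw [Complex.zero_re] at h
  refine h.congr fun x => ?_
  have hsum : ∑ k ∈ Finset.Icc 1 ⌊x⌋₊,
      (1 : DirichletCharacter ℂ r) k * (ArithmeticFunction.moebius k : ℂ) =
      ((∑ m ∈ (Finset.Icc 1 ⌊x⌋₊).filter (fun m => Nat.Coprime m r),
        (ArithmeticFunction.moebius m : ℝ) : ℝ) : ℂ) := by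
    rw [Finset.sum_filter]
    push_cast
    refine Finset.sum_congr rfl fun k _ => ?_
    split_ifs with hk
    · rw [MulChar.one_apply ((ZMod.isUnit_iff_coprime k r).2 hk)]; simp
    · rw [MulChar.map_nonunit _ (mt (ZMod.isUnit_iff_coprime k r).1 hk), zero_mul, Complex.ofReal_zero]
  rw [Function.comp_apply, hsum, ← Complex.ofReal_div, Complex.ofReal_re]
end

section
/- For every integer k ≥ 13 there exist consecutive odd primes p₁ < p₂ < p₃ (i.e., p₁, p₂, p₃ are consecutive elements of the sequence of primes) such that p₃ ≤ k < p₁ + p₂. -/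
/-- The central binomial coefficient bound from Erdős' proof of Bertrand's postulate, keeping track
of the number of primes in `(n, 2n]`. -/
theorem centralBinom_le_mul_pow_card_primes (n : ℕ) (hn : 2 < n) :
    n.centralBinom ≤ (2 * n) ^ Nat.sqrt (2 * n) * 4 ^ (2 * n / 3) *
      (2 * n) ^ ((Finset.Ioc n (2 * n)).filter Nat.Prime).card := by
  let S := {p ∈ Finset.range (2 * n + 1) | Nat.Prime p}
  let f x := x ^ n.centralBinom.factorization x
  have hf (p : ℕ) : f p ≤ 2 * n := Nat.pow_factorization_choose_le (by omega)
  have hprod : ∏ x ∈ S, f x = n.centralBinom := by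
    rw [← n.prod_pow_factorization_centralBinom]
    refine Finset.prod_filter_of_ne fun p _ h => ?_
    contrapose h
    simp only [f]
    rw [Nat.factorization_eq_zero_of_not_prime n.centralBinom h, pow_zero]
  rw [← hprod, ← Finset.prod_filter_not_mul_prod_filter S (n < ·),
    ← Finset.prod_filter_mul_prod_filter_not (S.filter (¬ n < ·)) (· ≤ Nat.sqrt (2 * n))]
  refine Nat.mul_le_mul (Nat.mul_le_mul ?_ ?_) ?_
  · refine (Finset.prod_le_pow_card _ _ _ fun p _ => hf p).trans
      (Nat.pow_le_pow_right (by omega) ?_)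
    have hcard : (Finset.Icc 1 (Nat.sqrt (2 * n))).card = Nat.sqrt (2 * n) := by simp
    refine (Finset.card_le_card fun p hp => ?_).trans hcard.le
    simp only [S, Finset.mem_filter] at hp
    exact Finset.mem_Icc.mpr ⟨hp.1.1.2.one_le, hp.2⟩
  · refine le_trans ?_ (primorial_le_four_pow (2 * n / 3))
    rw [primorial, ← Finset.prod_filter_of_ne (p := (· ≤ 2 * n / 3))]
    · refine (Finset.prod_le_prod' fun p hp => (?_ : f p ≤ p)).trans
        (Finset.prod_le_prod_of_subset_of_one_le' (fun p hp => ?_) fun p hp _ => ?_)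
      · simp only [S, Finset.mem_filter, not_le] at hp
        refine (Nat.pow_le_pow_right hp.1.1.1.2.pos ?_).trans (pow_one p).le
        exact Nat.factorization_choose_le_one (Nat.sqrt_lt'.mp hp.1.2)
      · simp only [S, Finset.mem_filter] at hp
        simp only [Finset.mem_filter, Finset.mem_range]
        exact ⟨by omega, hp.1.1.1.2⟩
      · exact (Finset.mem_filter.1 hp).2.one_le
    · intro p hp hne
      contrapose! hne
      simp only [S, Finset.mem_filter, not_lt] at hp
      simp only [f]
      rw [Nat.factorization_centralBinom_of_two_mul_self_lt_three_mul hn hp.1.2 (by omega),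
        pow_zero]
  · refine (Finset.prod_le_pow_card _ _ _ fun p _ => hf p).trans
      (Nat.pow_le_pow_right (by omega) (Finset.card_le_card fun p hp => ?_))
    simp only [S, Finset.mem_filter, Finset.mem_range] at hp
    simp only [Finset.mem_filter, Finset.mem_Ioc]
    exact ⟨⟨hp.2, by omega⟩, hp.1.2⟩

theorem sqrt_add_three_mul_log_le {x : ℝ} (hx : 2048 ≤ x) :
    (√x + 3) * Real.log x ≤ x / 3 * Real.log 2 := by
  obtain ⟨t, ht0, rfl⟩ : ∃ t : ℝ, 0 ≤ t ∧ t ^ 4 = x :=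
    ⟨√√x, by positivity, by
      rw [show 4 = 2 * 2 from rfl, pow_mul, Real.sq_sqrt (by positivity),
        Real.sq_sqrt (by linarith)]⟩
  have ht : 6.7 ≤ t := by
    by_contra! h
    have : t ^ 4 ≤ 6.7 ^ 4 := pow_le_pow_left₀ ht0 h.le 4
    norm_num at this
    linarith
  have hsqrt : √(t ^ 4) = t ^ 2 := by
    rw [show t ^ 4 = (t ^ 2) ^ 2 by ring, Real.sqrt_sq (by positivity)]
  have hlog : Real.log t ≤ 3 * Real.log 2 + t / 8 - 1 := by
    have h := Real.log_le_sub_one_of_pos (show 0 < t / 8 by linarith)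
    rw [Real.log_div (by linarith) (by norm_num), show (8 : ℝ) = 2 ^ 3 by norm_num,
      Real.log_pow] at h
    push_cast at h
    linarith
  have hlo := Real.log_two_gt_d9
  have hhi := Real.log_two_lt_d9
  rw [hsqrt, Real.log_pow]
  push_cast
  calc (t ^ 2 + 3) * (4 * Real.log t) ≤ (t ^ 2 + 3) * (4 * (1.08 + t / 8)) := by
        gcongr; linarith
    _ ≤ t ^ 4 / 3 * 0.69 := by
        obtain ⟨u, hu, rfl⟩ : ∃ u : ℝ, 0 ≤ u ∧ t = 6.7 + u := ⟨t - 6.7, by linarith, by ring⟩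
        have h2 := pow_nonneg hu 2
        have h3 := pow_nonneg hu 3
        have h4 := pow_nonneg hu 4
        nlinarith
    _ ≤ t ^ 4 / 3 * Real.log 2 := by gcongr; linarith

theorem mul_two_mul_pow_sqrt_add_two_le_four_pow {n : ℕ} (hn : 1024 ≤ n) :
    n * ((2 * n) ^ Nat.sqrt (2 * n) * 4 ^ (2 * n / 3) * (2 * n) ^ 2) ≤ 4 ^ n := by
  have hn' : (1024 : ℝ) ≤ n := by exact_mod_cast hn
  rw [← @Nat.cast_le ℝ]
  push_cast
  have hpos : (0 : ℝ) < n := by linarith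
  rw [← Real.log_le_log_iff (by positivity) (by positivity), Real.log_mul (by positivity)
    (by positivity), Real.log_mul (by positivity) (by positivity),
    Real.log_mul (by positivity) (by positivity), Real.log_pow, Real.log_pow, Real.log_pow,
    Real.log_pow, show (4 : ℝ) = 2 ^ 2 by norm_num, Real.log_pow]
  have hmain := sqrt_add_three_mul_log_le (show (2048 : ℝ) ≤ 2 * n by linarith)
  have hlog : Real.log n ≤ Real.log (2 * n) := Real.log_le_log hpos (by linarith)
  have hlog0 : 0 ≤ Real.log (2 * n) := Real.log_nonneg (by linarith)
  have hsqrt : (Nat.sqrt (2 * n) : ℝ) ≤ √(2 * n) := by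
    exact_mod_cast Real.nat_sqrt_le_real_sqrt (a := 2 * n)
  have hdiv : ((2 * n / 3 : ℕ) : ℝ) ≤ 2 * n / 3 := by
    exact_mod_cast Nat.cast_div_le (α := ℝ) (m := 2 * n) (n := 3)
  have hlog2 := Real.log_nonneg one_le_two
  have h1 := mul_le_mul_of_nonneg_right hsqrt hlog0
  have h2 := mul_le_mul_of_nonneg_right hdiv hlog2
  push_cast
  linarith

theorem three_le_card_primes_Ioc {n : ℕ} (hn : 1024 ≤ n) :
    3 ≤ ((Finset.Ioc n (2 * n)).filter Nat.Prime).card := by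
  by_contra! hcard
  have hlt := Nat.four_pow_lt_mul_centralBinom n (by omega)
  refine hlt.not_ge (le_trans ?_ (mul_two_mul_pow_sqrt_add_two_le_four_pow hn))
  refine Nat.mul_le_mul_left n ((centralBinom_le_mul_pow_card_primes n (by omega)).trans ?_)
  exact Nat.mul_le_mul_left _ (Nat.pow_le_pow_right (by omega) (by omega))

theorem exists_three_primes_half_lt {k : ℕ} (hk : 2048 ≤ k) :
    ∃ a b c : ℕ, a.Prime ∧ b.Prime ∧ c.Prime ∧ 2 < a ∧ a < b ∧ b < c ∧ c ≤ k ∧ k < a + b := by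
  have hcard := three_le_card_primes_Ioc (n := k / 2) (by omega)
  let e := Finset.orderEmbOfCardLe _ hcard
  have he (i : Fin 3) : (k / 2 < e i ∧ e i ≤ 2 * (k / 2)) ∧ (e i).Prime := by
    simpa only [Finset.mem_filter, Finset.mem_Ioc] using Finset.orderEmbOfCardLe_mem _ hcard i
  have h01 : e 0 < e 1 := e.strictMono (by decide)
  have h12 : e 1 < e 2 := e.strictMono (by decide)
  have h0 := (he 0).1
  have h2 := (he 2).1
  exact ⟨e 0, e 1, e 2, (he 0).2, (he 1).2, (he 2).2, by omega, h01, h12, by omega, by omega⟩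

/-- The largest prime below `m`, given a prime `a < m`. -/
theorem Nat.Prime.exists_greatest_prime_lt {a m : ℕ} (ha : a.Prime) (ham : a < m) :
    ∃ p : ℕ, p.Prime ∧ a ≤ p ∧ p < m ∧ ∀ q : ℕ, q.Prime → ¬(p < q ∧ q < m) := by
  obtain ⟨p, hp, hmax⟩ := Finset.exists_max_image ((Finset.range m).filter Nat.Prime) id
    ⟨a, by simp [ha, ham]⟩
  simp only [Finset.mem_filter, Finset.mem_range, id] at hp hmax
  exact ⟨p, hp.2, hmax a ⟨ham, ha⟩, hp.1,
    fun q hq h => (hmax q ⟨h.2, hq⟩).not_gt h.1⟩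

/-- Three primes, not necessarily consecutive, may be replaced by the three largest ones up to
`k`. -/
theorem exists_consecutive_primes_of_primes {a b c k : ℕ} (ha : a.Prime) (hb : b.Prime)
    (hc : c.Prime) (ha2 : 2 < a) (hab : a < b) (hbc : b < c) (hck : c ≤ k) (hk : k < a + b) :
    ∃ p₁ p₂ p₃ : ℕ, p₁.Prime ∧ p₂.Prime ∧ p₃.Prime ∧
      Odd p₁ ∧ p₁ < p₂ ∧ p₂ < p₃ ∧
      (∀ q : ℕ, q.Prime → ¬(p₁ < q ∧ q < p₂)) ∧
      (∀ q : ℕ, q.Prime → ¬(p₂ < q ∧ q < p₃)) ∧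
      p₃ ≤ k ∧ k < p₁ + p₂ := by
  obtain ⟨p₃, hp₃, hcp, hpk, -⟩ := hc.exists_greatest_prime_lt (Nat.lt_succ_of_le hck)
  obtain ⟨p₂, hp₂, hbp, h23, hgap₂⟩ := hb.exists_greatest_prime_lt (hbc.trans_le hcp)
  obtain ⟨p₁, hp₁, hap, h12, hgap₁⟩ := ha.exists_greatest_prime_lt (hab.trans_le hbp)
  exact ⟨p₁, p₂, p₃, hp₁, hp₂, hp₃, hp₁.odd_of_ne_two (by omega), h12, h23, hgap₁, hgap₂,
    Nat.le_of_lt_succ hpk, by omega⟩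

theorem exists_three_primes_of_lt {k : ℕ} (hk : 13 ≤ k) (hk' : k < 2048) :
    ∃ a b c : ℕ, a.Prime ∧ b.Prime ∧ c.Prime ∧ 2 < a ∧ a < b ∧ b < c ∧ c ≤ k ∧ k < a + b := by
  obtain h | h | h | h | h | h | h | h | h | h :
      k < 17 ∨ 17 ≤ k ∧ k < 24 ∨ 24 ≤ k ∧ k < 36 ∨ 36 ≤ k ∧ k < 52 ∨ 52 ≤ k ∧ k < 84 ∨
      84 ≤ k ∧ k < 152 ∨ 152 ≤ k ∧ k < 288 ∨ 288 ≤ k ∧ k < 548 ∨ 548 ≤ k ∧ k < 1064 ∨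
      1064 ≤ k := by omega
  · exact ⟨7, 11, 13, by norm_num, by norm_num, by norm_num, by omega⟩
  · exact ⟨11, 13, 17, by norm_num, by norm_num, by norm_num, by omega⟩
  · exact ⟨17, 19, 23, by norm_num, by norm_num, by norm_num, by omega⟩
  · exact ⟨23, 29, 31, by norm_num, by norm_num, by norm_num, by omega⟩
  · exact ⟨41, 43, 47, by norm_num, by norm_num, by norm_num, by omega⟩
  · exact ⟨73, 79, 83, by norm_num, by norm_num, by norm_num, by omega⟩
  · exact ⟨139, 149, 151, by norm_num, by norm_num, by norm_num, by omega⟩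
  · exact ⟨271, 277, 281, by norm_num, by norm_num, by norm_num, by omega⟩
  · exact ⟨523, 541, 547, by norm_num, by norm_num, by norm_num, by omega⟩
  · exact ⟨1051, 1061, 1063, by norm_num, by norm_num, by norm_num, by omega⟩

theorem stmt10 (k : ℕ) (hk : 13 ≤ k) :
    ∃ p₁ p₂ p₃ : ℕ, p₁.Prime ∧ p₂.Prime ∧ p₃.Prime ∧
      Odd p₁ ∧ p₁ < p₂ ∧ p₂ < p₃ ∧
      (∀ q : ℕ, q.Prime → ¬(p₁ < q ∧ q < p₂)) ∧
      (∀ q : ℕ, q.Prime → ¬(p₂ < q ∧ q < p₃)) ∧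
      p₃ ≤ k ∧ k < p₁ + p₂ := by
  obtain ⟨a, b, c, ha, hb, hc, ha2, hab, hbc, hck, hkab⟩ :=
    (lt_or_ge k 2048).elim (exists_three_primes_of_lt hk) exists_three_primes_half_lt
  exact exists_consecutive_primes_of_primes ha hb hc ha2 hab hbc hck hkab
end

section
/- For every n > 1 and every k ≥ 1, the coefficients of the n-th cyclotomic polynomial satisfy the recursion k·a_n(k) = −Σ_{m=0}^{k−1} a_n(m)·r_n(k−m), where r_n(j) = Σ_{d | gcd(n,j)} d·μ(n/d) is the Ramanujan sum. -/
/-- The Ramanujan sum, via the formula `r_n(j) = Σ_{d ∣ gcd(n,j)} d μ(n/d)`. -/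
def ramanujanInt (n j : ℕ) : ℤ :=
  ∑ d ∈ (Nat.gcd n j).divisors, (d : ℤ) * ArithmeticFunction.moebius (n / d)

open PowerSeries in
/-- The logarithmic derivative `X f' / f` of a power series `f` over `ℚ`. -/
noncomputable def eulerLogDeriv (f : PowerSeries ℚ) : PowerSeries ℚ :=
  X * derivative ℚ f * f⁻¹

open PowerSeries in
theorem mul_eulerLogDeriv {f : PowerSeries ℚ} (hf : constantCoeff f ≠ 0) :
    f * eulerLogDeriv f = X * derivative ℚ f := by
  rw [eulerLogDeriv, mul_left_comm, PowerSeries.mul_inv_cancel f hf, mul_one]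

open PowerSeries in
theorem eulerLogDeriv_eq_of_mul_eq {f g : PowerSeries ℚ} (hf : constantCoeff f ≠ 0)
    (h : f * g = X * derivative ℚ f) : eulerLogDeriv f = g := by
  rw [eulerLogDeriv, ← h, mul_right_comm, PowerSeries.mul_inv_cancel f hf, one_mul]

open PowerSeries in
theorem eulerLogDeriv_mul {f g : PowerSeries ℚ} (hf : constantCoeff f ≠ 0)
    (hg : constantCoeff g ≠ 0) :
    eulerLogDeriv (f * g) = eulerLogDeriv f + eulerLogDeriv g := by
  refine eulerLogDeriv_eq_of_mul_eq (by simp [hf, hg]) ?_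
  rw [Derivation.leibniz, smul_eq_mul, smul_eq_mul]
  linear_combination g * mul_eulerLogDeriv hf + f * mul_eulerLogDeriv hg

open PowerSeries in
theorem eulerLogDeriv_prod {ι : Type*} (s : Finset ι) (f : ι → PowerSeries ℚ)
    (hf : ∀ i ∈ s, constantCoeff (f i) ≠ 0) :
    eulerLogDeriv (∏ i ∈ s, f i) = ∑ i ∈ s, eulerLogDeriv (f i) := by
  classical
  induction s using Finset.induction_on with
  | empty => simp [eulerLogDeriv]
  | insert a s ha ih =>
    have hs : ∀ i ∈ s, constantCoeff (f i) ≠ 0 := fun i hi => hf i (Finset.mem_insert_of_mem hi)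
    rw [Finset.prod_insert ha, Finset.sum_insert ha, eulerLogDeriv_mul, ih hs]
    · exact hf a (Finset.mem_insert_self a s)
    · rw [map_prod]
      exact Finset.prod_ne_zero_iff.mpr hs

open PowerSeries in
theorem eulerLogDeriv_X_pow_sub_one {n : ℕ} (hn : 0 < n) :
    eulerLogDeriv ((X : PowerSeries ℚ) ^ n - 1) =
      PowerSeries.mk fun j => if 0 < j ∧ n ∣ j then -(n : ℚ) else 0 := by
  refine eulerLogDeriv_eq_of_mul_eq (by simp [hn.ne']) ?_
  have hd : (X : PowerSeries ℚ) * derivative ℚ ((X : PowerSeries ℚ) ^ n - 1) =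
      C (n : ℚ) * X ^ n := by
    obtain ⟨m, rfl⟩ : ∃ m, n = m + 1 := ⟨n - 1, by omega⟩
    rw [map_sub, Derivation.leibniz_pow]
    simp [pow_succ]
    ring
  rw [hd]
  ext j
  rw [sub_mul, one_mul, map_sub, coeff_X_pow_mul', coeff_C_mul, coeff_X_pow, coeff_mk]
  by_cases hj : n ≤ j
  · obtain ⟨i, rfl⟩ := Nat.exists_eq_add_of_le hj
    rcases Nat.eq_zero_or_pos i with rfl | hi
    · simp [hn]
    · simp [hn, hi, hi.ne']
  · have h0 : ¬ (0 < j ∧ n ∣ j) := fun h => hj (Nat.le_of_dvd h.1 h.2)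
    have h1 : j ≠ n := by omega
    simp [hj, h0, h1]

open PowerSeries in
theorem constantCoeff_cyclotomic_ne_zero (n : ℕ) :
    constantCoeff ((Polynomial.cyclotomic n ℚ : Polynomial ℚ) : PowerSeries ℚ) ≠ 0 := by
  rw [Polynomial.constantCoeff_coe]
  rcases lt_trichotomy n 1 with h | rfl | h
  · obtain rfl : n = 0 := by omega
    simp
  · simp
  · simp [Polynomial.cyclotomic_coeff_zero ℚ h]

open PowerSeries in
theorem sum_divisors_eulerLogDeriv_cyclotomic {n : ℕ} (hn : 0 < n) :
    ∑ d ∈ n.divisors, eulerLogDeriv (Polynomial.cyclotomic d ℚ : PowerSeries ℚ) =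
      PowerSeries.mk fun j => if 0 < j ∧ n ∣ j then -(n : ℚ) else 0 := by
  rw [← eulerLogDeriv_prod _ _ fun d _ => constantCoeff_cyclotomic_ne_zero d,
    ← eulerLogDeriv_X_pow_sub_one hn]
  congr 1
  have h := congrArg (Polynomial.coeToPowerSeries.ringHom (R := ℚ))
    (Polynomial.prod_cyclotomic_eq_X_pow_sub_one hn ℚ)
  simpa [map_prod] using h

open PowerSeries in
theorem coeff_eulerLogDeriv_cyclotomic {n : ℕ} (hn : 0 < n) (j : ℕ) :
    coeff j (eulerLogDeriv (Polynomial.cyclotomic n ℚ : PowerSeries ℚ)) =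
      if 0 < j then -(ramanujanInt n j : ℚ) else 0 := by
  have h := (ArithmeticFunction.sum_eq_iff_sum_mul_moebius_eq
    (f := fun d => coeff j (eulerLogDeriv (Polynomial.cyclotomic d ℚ : PowerSeries ℚ)))
    (g := fun d => if 0 < j ∧ d ∣ j then -(d : ℚ) else 0)).mp (fun d hd => by
      rw [← map_sum, sum_divisors_eulerLogDeriv_cyclotomic hd, coeff_mk]) n hn
  rw [← h, Nat.sum_divisorsAntidiagonal'
    (f := fun a b => ((ArithmeticFunction.moebius a : ℤ) : ℚ) *
      if 0 < j ∧ b ∣ j then -(b : ℚ) else 0)]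
  split_ifs with hj
  · have hg : (n.gcd j).divisors = n.divisors.filter (· ∣ j) := by
      ext d
      simp [Nat.dvd_gcd_iff, hn.ne']
    rw [ramanujanInt, hg, Finset.sum_filter]
    push_cast
    rw [← Finset.sum_neg_distrib]
    refine Finset.sum_congr rfl fun d _ => ?_
    by_cases hd : d ∣ j <;> simp [hj, hd, mul_comm]
  · simp [hj]

theorem stmt14 (n k : ℕ) (hn : 1 < n) (hk : 1 ≤ k) :
    (k : ℤ) * (Polynomial.cyclotomic n ℤ).coeff k =
      -∑ m ∈ Finset.range k, (Polynomial.cyclotomic n ℤ).coeff m * ramanujanInt n (k - m) := by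
  have hc (m : ℕ) : (Polynomial.cyclotomic n ℚ).coeff m =
      ((Polynomial.cyclotomic n ℤ).coeff m : ℚ) := by
    rw [← Polynomial.map_cyclotomic_int n ℚ, Polynomial.coeff_map, eq_intCast]
  have h := congrArg (PowerSeries.coeff k)
    (mul_eulerLogDeriv (constantCoeff_cyclotomic_ne_zero n))
  obtain ⟨i, rfl⟩ : ∃ i, k = i + 1 := ⟨k - 1, by omega⟩
  rw [PowerSeries.coeff_succ_X_mul, PowerSeries.coeff_derivative, PowerSeries.coeff_mul,
    Finset.Nat.sum_antidiagonal_eq_sum_range_succ_mk, Finset.sum_range_succ] at h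
  simp only [coeff_eulerLogDeriv_cyclotomic (zero_lt_one.trans hn), Polynomial.coeff_coe, hc,
    Nat.sub_self, lt_irrefl, if_false, mul_zero, add_zero] at h
  rw [Finset.sum_congr rfl fun m hm => by
    rw [if_pos (Nat.sub_pos_of_lt (Finset.mem_range.mp hm)), mul_neg],
    Finset.sum_neg_distrib] at h
  have h' : (((i + 1 : ℕ) : ℤ) : ℚ) * ((Polynomial.cyclotomic n ℤ).coeff (i + 1) : ℚ) =
      -∑ m ∈ Finset.range (i + 1), ((Polynomial.cyclotomic n ℤ).coeff m : ℚ) *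
        (ramanujanInt n (i + 1 - m) : ℚ) := by
    rw [h]
    push_cast
    ring
  exact_mod_cast h'
end
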